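/- Let a > -1 and let u be a C² function on an open set of ℝ^{n+1} containing the closed ball, satisfying div(|y|^a ∇u) = 0 (in the weak sense, or pointwise Δu + (a/y)∂_y u = 0 on {y≠0} together with |y|^a ∂_y u → 0 as y → 0). Then for every ball B_r(X₀) with center X₀ = (x₀,0) on the hyperplane {y=0} contained in the domain, u(X₀) = (1/(|S^n|_a r^{n+a})) ∫_{∂B_r(X₀)} |y|^a u dσ, where |S^n|_a = ∫_{∂B_1} |y|^a dσ. -/

import Mathlib

open MeasureTheory Metric Set

noncomputable section

/-- Surface measure on the unit sphere of `ℝ^{n+1}`, obtained from Lebesgue measure. -/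
def sphereMeasure (n : ℕ) :
    Measure (Metric.sphere (0 : EuclideanSpace ℝ (Fin (n + 1))) 1) :=
  (volume : Measure (EuclideanSpace ℝ (Fin (n + 1)))).toSphere

/-- Surface integral of `f` over the sphere `∂B_r(X₀)` (with the Jacobian factor `r^n`). -/
def sphInt (n : ℕ) (f : EuclideanSpace ℝ (Fin (n + 1)) → ℝ)
    (X₀ : EuclideanSpace ℝ (Fin (n + 1))) (r : ℝ) : ℝ :=
  r ^ n * ∫ ω, f (X₀ + r • (ω : EuclideanSpace ℝ (Fin (n + 1)))) ∂(sphereMeasure n)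

/-- Partial derivative in the last (`y`) direction. -/
def lastD {n : ℕ} (u : EuclideanSpace ℝ (Fin (n + 1)) → ℝ)
    (X : EuclideanSpace ℝ (Fin (n + 1))) : ℝ :=
  fderiv ℝ u X (EuclideanSpace.single (Fin.last n) 1)

/-- The Euclidean Laplacian computed in coordinates. -/
def lapl {n : ℕ} (u : EuclideanSpace ℝ (Fin (n + 1)) → ℝ)
    (X : EuclideanSpace ℝ (Fin (n + 1))) : ℝ :=
  ∑ i, fderiv ℝ (fun Y => fderiv ℝ u Y (EuclideanSpace.single i 1)) X
    (EuclideanSpace.single i 1)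

theorem integrableOn_abs_rpow {a : ℝ} (ha : -1 < a) (R : ℝ) :
    IntegrableOn (fun t : ℝ => |t| ^ a) (Icc (-R) R) := by
  have hpos : ∀ S : ℝ, IntegrableOn (fun t : ℝ => |t| ^ a) (Icc 0 S) := by
    intro S
    rcases le_or_gt 0 S with hS | hS
    · have h := (intervalIntegral.intervalIntegrable_rpow' (a := 0) (b := S) ha).1
      rw [integrableOn_Icc_iff_integrableOn_Ioc]
      exact h.congr_fun (fun t ht => by simp only [abs_of_pos ht.1]) measurableSet_Ioc
    · simp [Icc_eq_empty_of_lt hS]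
  have hneg : IntegrableOn (fun t : ℝ => |t| ^ a) (Icc (-R) 0) := by
    have h := (hpos R).comp_neg
    simpa using h
  refine (hneg.union (hpos R)).mono_set fun t ht => ?_
  rcases le_total t 0 with h | h
  · exact Or.inl ⟨ht.1, h⟩
  · exact Or.inr ⟨h, ht.2⟩

theorem locallyIntegrable_abs_last_rpow (n : ℕ) {a : ℝ} (ha : -1 < a) :
    LocallyIntegrable (fun X : EuclideanSpace ℝ (Fin (n + 1)) => |X (Fin.last n)| ^ a) := by
  rw [locallyIntegrable_iff]
  intro k hk
  obtain ⟨R, hR⟩ := hk.isBounded.subset_closedBall 0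
  let g : Fin (n + 1) → ℝ → ℝ := fun i =>
    (Icc (-R) R).indicator (if i = Fin.last n then fun t => |t| ^ a else fun _ => 1)
  have hg : ∀ i, Integrable (g i) := by
    intro i
    rw [integrable_indicator_iff measurableSet_Icc]
    split_ifs
    · exact integrableOn_abs_rpow ha R
    · exact continuous_const.integrableOn_Icc
  have hprod : Integrable (fun X : EuclideanSpace ℝ (Fin (n + 1)) => ∏ i, g i (X i)) :=
    (PiLp.volume_preserving_ofLp (Fin (n + 1))).integrable_comp_of_integrable
      (Integrable.fintype_prod hg)
  refine (hprod.integrableOn (s := k)).congr_fun (fun X hX => ?_) hk.measurableSet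
  have hmem : ∀ i, X i ∈ Icc (-R) R := by
    intro i
    have h1 : ‖X i‖ ≤ ‖X‖ := PiLp.norm_apply_le X i
    have h2 : ‖X‖ ≤ R := by simpa using hR hX
    exact abs_le.1 (h1.trans h2)
  simp only [g, indicator_of_mem (hmem _)]
  rw [Finset.prod_eq_single (Fin.last n)]
  · simp
  · intro i _ hi
    simp [hi]
  · simp

theorem integral_eq_zero_of_last_line {n : ℕ} {f : EuclideanSpace ℝ (Fin (n + 1)) → ℝ}
    (hf : Integrable f)
    (h : ∀ x : EuclideanSpace ℝ (Fin (n + 1)), x (Fin.last n) = 0 →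
      ∫ t : ℝ, f (x + t • EuclideanSpace.single (Fin.last n) 1) = 0) :
    ∫ X, f X = 0 := by
  let e := MeasurableEquiv.piFinSuccAbove (fun _ : Fin (n + 1) => ℝ) (Fin.last n)
  have he : MeasurePreserving e.symm :=
    (volume_preserving_piFinSuccAbove (fun _ : Fin (n + 1) => ℝ) (Fin.last n)).symm e
  have hmp : MeasurePreserving (MeasurableEquiv.toLp 2 (Fin (n + 1) → ℝ)) :=
    PiLp.volume_preserving_toLp (Fin (n + 1))
  have hcomp := hmp.comp he
  have hemb : MeasurableEmbedding (MeasurableEquiv.toLp 2 (Fin (n + 1) → ℝ) ∘ e.symm) :=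
    (MeasurableEquiv.measurableEmbedding _).comp e.symm.measurableEmbedding
  have hint := (hcomp.integrable_comp_emb hemb).2 hf
  rw [← hcomp.integral_comp hemb]
  rw [Measure.volume_eq_prod] at hint ⊢
  refine (integral_prod_symm _ hint).trans ?_
  refine integral_eq_zero_of_ae (.of_forall fun y => ?_)
  rw [Pi.zero_apply, ← h (WithLp.toLp 2 (Fin.insertNth (Fin.last n) 0 y)) (by simp)]
  refine integral_congr_ae (.of_forall fun t => ?_)
  simp only [Function.comp_apply]
  congr 1
  ext i
  refine Fin.lastCases ?_ (fun j => ?_) i <;> simp [e]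

theorem integrable_polar {n : ℕ} {f : EuclideanSpace ℝ (Fin (n + 1)) → ℝ} (hf : Integrable f) :
    Integrable (fun p : sphere (0 : EuclideanSpace ℝ (Fin (n + 1))) 1 × Ioi (0 : ℝ) =>
      f ((p.2 : ℝ) • (p.1 : EuclideanSpace ℝ (Fin (n + 1)))))
      ((sphereMeasure n).prod (Measure.volumeIoiPow n)) := by
  have hmp := (volume : Measure
    (EuclideanSpace ℝ (Fin (n + 1)))).measurePreserving_homeomorphUnitSphereProd
  have hemb := (homeomorphUnitSphereProd
    (EuclideanSpace ℝ (Fin (n + 1)))).measurableEmbedding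
  have hdim : Module.finrank ℝ (EuclideanSpace ℝ (Fin (n + 1))) - 1 = n := by simp
  rw [hdim] at hmp
  rw [sphereMeasure, ← hmp.integrable_comp_emb hemb]
  have := (integrableOn_iff_comap_subtypeVal (measurableSet_singleton 0).compl).1
    (hf.integrableOn (s := ({0}ᶜ : Set (EuclideanSpace ℝ (Fin (n + 1))))))
  refine this.congr (.of_forall fun x => ?_)
  have hx : ‖(x : EuclideanSpace ℝ (Fin (n + 1)))‖ ≠ 0 := norm_ne_zero_iff.2 x.2
  simp [smul_smul, hx]

theorem integral_polar {n : ℕ} {f : EuclideanSpace ℝ (Fin (n + 1)) → ℝ} (hf : Integrable f) :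
    ∫ X, f X = ∫ s in Ioi (0 : ℝ), s ^ n *
      ∫ ω, f (s • (ω : EuclideanSpace ℝ (Fin (n + 1)))) ∂(sphereMeasure n) := by
  have hmp := (volume : Measure
    (EuclideanSpace ℝ (Fin (n + 1)))).measurePreserving_homeomorphUnitSphereProd
  have hemb := (homeomorphUnitSphereProd
    (EuclideanSpace ℝ (Fin (n + 1)))).measurableEmbedding
  have hdim : Module.finrank ℝ (EuclideanSpace ℝ (Fin (n + 1))) - 1 = n := by simp
  rw [hdim] at hmp
  have : SigmaFinite (sphereMeasure n) := by unfold sphereMeasure; infer_instance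
  have hprod : ∫ X, f X = ∫ p, f ((p.2 : ℝ) • (p.1 : EuclideanSpace ℝ (Fin (n + 1))))
      ∂((sphereMeasure n).prod (Measure.volumeIoiPow n)) := by
    have hcompl : ∫ x : ({0}ᶜ : Set (EuclideanSpace ℝ (Fin (n + 1)))), f x
        ∂(Measure.comap Subtype.val volume) = ∫ X, f X := by
      rw [integral_subtype_comap (measurableSet_singleton _).compl f, restrict_compl_singleton]
    rw [sphereMeasure, ← hmp.integral_comp hemb, ← hcompl]
    refine integral_congr_ae (.of_forall fun x => ?_)
    have hx : ‖(x : EuclideanSpace ℝ (Fin (n + 1)))‖ ≠ 0 := norm_ne_zero_iff.2 x.2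
    simp [smul_smul, hx]
  rw [hprod, integral_prod_symm _ (integrable_polar hf), Measure.volumeIoiPow]
  simp only [ENNReal.ofReal]
  rw [integral_withDensity_eq_integral_smul
      ((measurable_subtype_coe.pow_const _).real_toNNReal),
    integral_subtype_comap measurableSet_Ioi fun s : ℝ => Real.toNNReal (s ^ n) •
      ∫ ω, f (s • (ω : EuclideanSpace ℝ (Fin (n + 1)))) ∂(sphereMeasure n)]
  refine setIntegral_congr_fun measurableSet_Ioi fun s hs => ?_
  simp only [NNReal.smul_def, Real.coe_toNNReal _ (pow_nonneg (le_of_lt hs) _), smul_eq_mul]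

theorem integrable_abs_last_rpow_sphereMeasure (n : ℕ) {a : ℝ} (ha : -1 < a) :
    Integrable (fun ω : sphere (0 : EuclideanSpace ℝ (Fin (n + 1))) 1 =>
      |(ω : EuclideanSpace ℝ (Fin (n + 1))) (Fin.last n)| ^ a) (sphereMeasure n) := by
  have hball : Integrable ((closedBall (0 : EuclideanSpace ℝ (Fin (n + 1))) 1).indicator
      fun X => |X (Fin.last n)| ^ a) :=
    (integrable_indicator_iff measurableSet_closedBall).2
      ((locallyIntegrable_abs_last_rpow n ha).integrableOn_isCompact (isCompact_closedBall 0 1))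
  have : SigmaFinite (sphereMeasure n) := by unfold sphereMeasure; infer_instance
  have hslice := (integrable_polar hball).prod_left_ae
  have hfreq : ∃ᵐ s ∂(Measure.volumeIoiPow n), s ∈ Iio (⟨1, mem_Ioi.2 one_pos⟩ : Ioi (0 : ℝ)) := by
    rw [frequently_ae_mem_iff, Measure.volumeIoiPow_apply_Iio]
    simp only [one_pow, ne_eq, ENNReal.ofReal_eq_zero, not_le]
    positivity
  obtain ⟨s, hs1, hs⟩ := (hfreq.and_eventually hslice).exists
  have hs0 : (0 : ℝ) < s := s.2
  have hs1' : (s : ℝ) < 1 := hs1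
  refine (hs.const_mul ((s : ℝ) ^ a)⁻¹).congr (.of_forall fun ω => ?_)
  have hω : ‖(ω : EuclideanSpace ℝ (Fin (n + 1)))‖ = 1 := norm_eq_of_mem_sphere ω
  have hmem : (s : ℝ) • (ω : EuclideanSpace ℝ (Fin (n + 1))) ∈
      closedBall (0 : EuclideanSpace ℝ (Fin (n + 1))) 1 := by
    simp [norm_smul, hω, abs_of_pos hs0, hs1'.le]
  have hsa : (s : ℝ) ^ a ≠ 0 := (Real.rpow_pos_of_pos hs0 a).ne'
  simp only [indicator_of_mem hmem, PiLp.smul_apply, smul_eq_mul, abs_mul,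
    abs_of_pos hs0]
  rw [Real.mul_rpow hs0.le (abs_nonneg _), inv_mul_cancel_left₀ hsa]

theorem integral_abs_last_rpow_sphereMeasure_pos (n : ℕ) {a : ℝ} (ha : -1 < a) :
    0 < ∫ ω : sphere (0 : EuclideanSpace ℝ (Fin (n + 1))) 1,
      |(ω : EuclideanSpace ℝ (Fin (n + 1))) (Fin.last n)| ^ a ∂(sphereMeasure n) := by
  rw [integral_pos_iff_support_of_nonneg (fun ω => by positivity)
    (integrable_abs_last_rpow_sphereMeasure n ha)]
  have hpos : (sphereMeasure n).IsOpenPosMeasure := by unfold sphereMeasure; infer_instance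
  have hopen : IsOpen {ω : sphere (0 : EuclideanSpace ℝ (Fin (n + 1))) 1 |
      (ω : EuclideanSpace ℝ (Fin (n + 1))) (Fin.last n) ≠ 0} :=
    isOpen_ne_fun (by fun_prop) continuous_const
  refine (hopen.measure_pos (sphereMeasure n)
    ⟨⟨EuclideanSpace.single (Fin.last n) 1, by simp⟩, by simp⟩).trans_le
      (measure_mono fun ω hω => ?_)
  exact (Real.rpow_pos_of_pos (abs_pos.2 hω) a).ne'

section sphericalMean

variable {n : ℕ} {a : ℝ} {w : EuclideanSpace ℝ (Fin (n + 1)) → ℝ}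

theorem hasDerivAt_weighted_sphere_integral (ha : -1 < a) (hw : ContDiff ℝ 1 w)
    (hsupp : HasCompactSupport w) (s : ℝ) :
    HasDerivAt (fun s : ℝ => ∫ ω : sphere (0 : EuclideanSpace ℝ (Fin (n + 1))) 1,
        |(ω : EuclideanSpace ℝ (Fin (n + 1))) (Fin.last n)| ^ a *
          w (s • (ω : EuclideanSpace ℝ (Fin (n + 1)))) ∂(sphereMeasure n))
      (∫ ω : sphere (0 : EuclideanSpace ℝ (Fin (n + 1))) 1,
        |(ω : EuclideanSpace ℝ (Fin (n + 1))) (Fin.last n)| ^ a *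
          fderiv ℝ w (s • (ω : EuclideanSpace ℝ (Fin (n + 1)))) ω ∂(sphereMeasure n)) s := by
  have hwt := integrable_abs_last_rpow_sphereMeasure n ha
  have hcw : Continuous w := hw.continuous
  have hcdw : Continuous (fderiv ℝ w) := hw.continuous_fderiv one_ne_zero
  obtain ⟨C, hC⟩ := hsupp.exists_bound_of_continuous hcw
  obtain ⟨D, hD⟩ := (hsupp.fderiv ℝ).exists_bound_of_continuous hcdw
  have hmeas : ∀ s : ℝ, AEStronglyMeasurable
      (fun ω : sphere (0 : EuclideanSpace ℝ (Fin (n + 1))) 1 =>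
        |(ω : EuclideanSpace ℝ (Fin (n + 1))) (Fin.last n)| ^ a *
          w (s • (ω : EuclideanSpace ℝ (Fin (n + 1))))) (sphereMeasure n) := fun s =>
    hwt.aestronglyMeasurable.mul
      (Continuous.aestronglyMeasurable (by fun_prop))
  refine (hasDerivAt_integral_of_dominated_loc_of_deriv_le (s := univ)
    (bound := fun ω : sphere (0 : EuclideanSpace ℝ (Fin (n + 1))) 1 =>
      |(ω : EuclideanSpace ℝ (Fin (n + 1))) (Fin.last n)| ^ a * D)
    (F' := fun s ω => |(ω : EuclideanSpace ℝ (Fin (n + 1))) (Fin.last n)| ^ a *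
      fderiv ℝ w (s • (ω : EuclideanSpace ℝ (Fin (n + 1)))) ω)
    Filter.univ_mem (.of_forall hmeas) ?_ ?_ ?_ (hwt.mul_const D) ?_).2
  · exact hwt.mul_bdd (c := C) (Continuous.aestronglyMeasurable (by fun_prop))
      (.of_forall fun ω => hC _)
  · exact hwt.aestronglyMeasurable.mul (Continuous.aestronglyMeasurable
      ((hcdw.comp (by fun_prop)).clm_apply continuous_subtype_val))
  · refine .of_forall fun ω s _ => ?_
    rw [norm_mul, Real.norm_of_nonneg (by positivity)]
    gcongr
    refine ((fderiv ℝ w _).le_opNorm _).trans ?_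
    simpa using hD (s • (ω : EuclideanSpace ℝ (Fin (n + 1))))
  · refine .of_forall fun ω s _ => HasDerivAt.const_mul _ ?_
    have h1 : HasDerivAt (fun s : ℝ => s • (ω : EuclideanSpace ℝ (Fin (n + 1))))
        (ω : EuclideanSpace ℝ (Fin (n + 1))) s := by
      simpa using (hasDerivAt_id s).smul_const (ω : EuclideanSpace ℝ (Fin (n + 1)))
    exact ((hw.differentiable one_ne_zero) _).hasFDerivAt.comp_hasDerivAt s h1

theorem continuous_weighted_sphere_integral_radial_deriv (ha : -1 < a) (hw : ContDiff ℝ 1 w)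
    (hsupp : HasCompactSupport w) :
    Continuous fun s : ℝ => ∫ ω : sphere (0 : EuclideanSpace ℝ (Fin (n + 1))) 1,
      |(ω : EuclideanSpace ℝ (Fin (n + 1))) (Fin.last n)| ^ a *
        fderiv ℝ w (s • (ω : EuclideanSpace ℝ (Fin (n + 1)))) ω ∂(sphereMeasure n) := by
  have hwt := integrable_abs_last_rpow_sphereMeasure n ha
  have hcdw : Continuous (fderiv ℝ w) := hw.continuous_fderiv one_ne_zero
  obtain ⟨D, hD⟩ := (hsupp.fderiv ℝ).exists_bound_of_continuous hcdw
  refine continuous_of_dominated (bound := fun ω : sphere (0 : EuclideanSpace ℝ (Fin (n + 1))) 1 =>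
      |(ω : EuclideanSpace ℝ (Fin (n + 1))) (Fin.last n)| ^ a * D)
    (fun s => ?_) (fun s => .of_forall fun ω => ?_) (hwt.mul_const D) (.of_forall fun ω => ?_)
  · exact hwt.aestronglyMeasurable.mul (Continuous.aestronglyMeasurable
      ((hcdw.comp (by fun_prop)).clm_apply continuous_subtype_val))
  · rw [norm_mul, Real.norm_of_nonneg (by positivity)]
    gcongr
    refine ((fderiv ℝ w _).le_opNorm _).trans ?_
    simpa using hD (s • (ω : EuclideanSpace ℝ (Fin (n + 1))))
  · exact continuous_const.mul ((hcdw.comp (by fun_prop)).clm_apply continuous_const)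

theorem integral_weighted_cutoff_radial_deriv_eq (ha : -1 < a) (hw : ContDiff ℝ 1 w) {ρ : ℝ}
    (hρ : 0 < ρ) :
    ∫ X : EuclideanSpace ℝ (Fin (n + 1)),
        |X (Fin.last n)| ^ a * (max (ρ ^ 2 - ‖X‖ ^ 2) 0 * fderiv ℝ w X X) =
      ∫ s in (0 : ℝ)..ρ, (ρ ^ 2 - s ^ 2) * (s ^ ((n : ℝ) + 1 + a) *
        ∫ ω : sphere (0 : EuclideanSpace ℝ (Fin (n + 1))) 1,
          |(ω : EuclideanSpace ℝ (Fin (n + 1))) (Fin.last n)| ^ a *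
            fderiv ℝ w (s • (ω : EuclideanSpace ℝ (Fin (n + 1)))) ω ∂(sphereMeasure n)) := by
  have hcdw : Continuous (fderiv ℝ w) := hw.continuous_fderiv one_ne_zero
  have hcont : Continuous fun X : EuclideanSpace ℝ (Fin (n + 1)) =>
      max (ρ ^ 2 - ‖X‖ ^ 2) 0 * fderiv ℝ w X X := by
    have := hcdw.clm_apply continuous_id
    fun_prop
  have hcpt : HasCompactSupport fun X : EuclideanSpace ℝ (Fin (n + 1)) =>
      max (ρ ^ 2 - ‖X‖ ^ 2) 0 * fderiv ℝ w X X := by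
    refine HasCompactSupport.intro (isCompact_closedBall 0 ρ) fun X hX => ?_
    have hX' : ρ < ‖X‖ := by simpa using hX
    rw [max_eq_right (by nlinarith), zero_mul]
  have hint := (locallyIntegrable_abs_last_rpow n ha).integrable_smul_right_of_hasCompactSupport
    hcont hcpt
  simp only [smul_eq_mul] at hint
  rw [integral_polar hint, intervalIntegral.integral_of_le hρ.le,
    ← integral_indicator measurableSet_Ioi, ← integral_indicator measurableSet_Ioc]
  congr 1
  ext s
  by_cases hs : 0 < s
  · rw [indicator_of_mem (show s ∈ Ioi (0 : ℝ) from hs)]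
    have hnorm : ∀ ω : sphere (0 : EuclideanSpace ℝ (Fin (n + 1))) 1,
        ‖s • (ω : EuclideanSpace ℝ (Fin (n + 1)))‖ = s := fun ω => by
      simp [norm_smul, abs_of_pos hs]
    have hfun : ∀ ω : sphere (0 : EuclideanSpace ℝ (Fin (n + 1))) 1,
        |(s • (ω : EuclideanSpace ℝ (Fin (n + 1)))) (Fin.last n)| ^ a *
          (max (ρ ^ 2 - ‖s • (ω : EuclideanSpace ℝ (Fin (n + 1)))‖ ^ 2) 0 *
            fderiv ℝ w (s • (ω : EuclideanSpace ℝ (Fin (n + 1))))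
              (s • (ω : EuclideanSpace ℝ (Fin (n + 1))))) =
        (s ^ a * max (ρ ^ 2 - s ^ 2) 0 * s) *
          (|(ω : EuclideanSpace ℝ (Fin (n + 1))) (Fin.last n)| ^ a *
            fderiv ℝ w (s • (ω : EuclideanSpace ℝ (Fin (n + 1)))) ω) := fun ω => by
      rw [hnorm, map_smul, PiLp.smul_apply, smul_eq_mul, smul_eq_mul, abs_mul, abs_of_pos hs,
        Real.mul_rpow hs.le (abs_nonneg _)]
      ring
    simp only [hfun, integral_const_mul]
    by_cases hsρ : s ≤ ρ
    · rw [indicator_of_mem (show s ∈ Ioc 0 ρ from ⟨hs, hsρ⟩), max_eq_left (by nlinarith),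
        Real.rpow_add hs, Real.rpow_add hs, Real.rpow_one, Real.rpow_natCast]
      ring
    · rw [indicator_of_notMem (fun h => hsρ h.2), max_eq_right (by nlinarith)]
      ring
  · rw [indicator_of_notMem (by simpa using hs), indicator_of_notMem (fun h => hs h.1)]

end sphericalMean

theorem eq_zero_of_forall_integral_sq_sub_sq_mul_eq_zero {h : ℝ → ℝ} (hh : Continuous h) {r : ℝ}
    (hzero : ∀ ρ ∈ Ioo 0 r, ∫ s in (0 : ℝ)..ρ, (ρ ^ 2 - s ^ 2) * h s = 0) :
    ∀ ρ ∈ Ioo 0 r, h ρ = 0 := by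
  have hH : ∀ ρ, HasDerivAt (fun ρ => ∫ s in (0 : ℝ)..ρ, h s) (h ρ) ρ := fun ρ =>
    intervalIntegral.integral_hasDerivAt_right (hh.intervalIntegrable _ _)
      (hh.stronglyMeasurableAtFilter _ _) hh.continuousAt
  have hh2 : Continuous fun s => s ^ 2 * h s := by fun_prop
  have hK : ∀ ρ, HasDerivAt (fun ρ => ∫ s in (0 : ℝ)..ρ, s ^ 2 * h s) (ρ ^ 2 * h ρ) ρ := fun ρ =>
    intervalIntegral.integral_hasDerivAt_right (hh2.intervalIntegrable _ _)
      (hh2.stronglyMeasurableAtFilter _ _) hh2.continuousAt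
  have hHzero : ∀ ρ ∈ Ioo 0 r, ∫ s in (0 : ℝ)..ρ, h s = 0 := by
    intro ρ hρ
    have hder := ((hasDerivAt_pow 2 ρ).mul (hH ρ)).sub (hK ρ)
    have hder0 : HasDerivAt ((fun ρ : ℝ => ρ ^ 2) * (fun ρ => ∫ s in (0 : ℝ)..ρ, h s) -
        fun ρ => ∫ s in (0 : ℝ)..ρ, s ^ 2 * h s) 0 ρ := by
      refine (hasDerivAt_const ρ (0 : ℝ)).congr_of_eventuallyEq ?_
      filter_upwards [isOpen_Ioo.mem_nhds hρ] with σ hσ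
      refine Eq.trans ?_ (hzero σ hσ)
      simp only [Pi.sub_apply, Pi.mul_apply, sub_mul]
      have hh1 : Continuous fun s => σ ^ 2 * h s := by fun_prop
      rw [intervalIntegral.integral_sub (hh1.intervalIntegrable _ _)
        (hh2.intervalIntegrable _ _), intervalIntegral.integral_const_mul]
    simpa [hρ.1.ne'] using hder.unique hder0
  intro ρ hρ
  refine (hH ρ).unique ((hasDerivAt_const ρ (0 : ℝ)).congr_of_eventuallyEq ?_)
  filter_upwards [isOpen_Ioo.mem_nhds hρ] with σ hσ using hHzero σ hσ

theorem weighted_sphere_integral_eq_of_integral_cutoff_eq_zero {n : ℕ} {a : ℝ} (ha : -1 < a)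
    {w : EuclideanSpace ℝ (Fin (n + 1)) → ℝ} (hw : ContDiff ℝ 1 w) (hsupp : HasCompactSupport w)
    {r : ℝ} (hr : 0 < r)
    (hzero : ∀ ρ ∈ Ioo 0 r, ∫ X : EuclideanSpace ℝ (Fin (n + 1)),
      |X (Fin.last n)| ^ a * (max (ρ ^ 2 - ‖X‖ ^ 2) 0 * fderiv ℝ w X X) = 0) :
    ∫ ω : sphere (0 : EuclideanSpace ℝ (Fin (n + 1))) 1,
        |(ω : EuclideanSpace ℝ (Fin (n + 1))) (Fin.last n)| ^ a *
          w (r • (ω : EuclideanSpace ℝ (Fin (n + 1)))) ∂(sphereMeasure n) =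
      w 0 * ∫ ω : sphere (0 : EuclideanSpace ℝ (Fin (n + 1))) 1,
        |(ω : EuclideanSpace ℝ (Fin (n + 1))) (Fin.last n)| ^ a ∂(sphereMeasure n) := by
  have hder := hasDerivAt_weighted_sphere_integral ha hw hsupp
  have hcont := continuous_weighted_sphere_integral_radial_deriv ha hw hsupp
  have hexp : 0 < (n : ℝ) + 1 + a := by
    have : (0 : ℝ) ≤ n := n.cast_nonneg
    linarith
  have hvanish := eq_zero_of_forall_integral_sq_sub_sq_mul_eq_zero
    ((Real.continuous_rpow_const hexp.le).mul hcont) (r := r) fun ρ hρ => by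
      refine Eq.trans ?_ (hzero ρ hρ)
      rw [integral_weighted_cutoff_radial_deriv_eq ha hw hρ.1]
      rfl
  obtain ⟨c, hc, hslope⟩ := exists_hasDerivAt_eq_slope _ _ hr
    (fun s _ => (hder s).continuousAt.continuousWithinAt) fun s _ => hder s
  have h0 := (mul_eq_zero.1 (hvanish c hc)).resolve_left (Real.rpow_pos_of_pos hc.1 _).ne'
  have hdiff := hslope.symm.trans h0
  rw [div_eq_zero_iff, or_iff_left (by linarith), sub_eq_zero] at hdiff
  rw [hdiff]
  simp only [zero_smul, integral_mul_const]
  rw [mul_comm]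

theorem hasDerivAt_abs_rpow_of_ne_zero (a : ℝ) {t : ℝ} (ht : t ≠ 0) :
    HasDerivAt (fun t : ℝ => |t| ^ a) (a / t * |t| ^ a) t := by
  have habs : |t| ≠ 0 := abs_ne_zero.2 ht
  convert (hasDerivAt_abs ht).rpow_const (p := a) (Or.inl habs) using 1
  rw [Real.rpow_sub_one habs]
  rcases lt_or_gt_of_ne ht with h | h
  · simp [h, abs_of_neg h]
    field_simp
  · simp [h, abs_of_pos h]
    field_simp

theorem integral_eq_zero_of_hasDerivAt_of_ne_zero {F f : ℝ → ℝ} {R : ℝ} (hR : 0 < R)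
    (hf : IntervalIntegrable f volume (-R) R)
    (hder : ∀ t, t ≠ 0 → HasDerivAt F (f t) t)
    (hlim : Filter.Tendsto F (nhdsWithin 0 {0}ᶜ) (nhds 0))
    (hneg : F (-R) = 0) (hpos : F R = 0) :
    ∫ t in (-R)..R, f t = 0 := by
  have hupd : ∀ t, t ≠ 0 → HasDerivAt (Function.update F 0 0) (f t) t := fun t ht =>
    (hder t ht).congr_of_eventuallyEq <| by
      filter_upwards [isOpen_ne.mem_nhds ht] with s hs using Function.update_of_ne hs _ _
  have hcont : Continuous (Function.update F 0 0) := by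
    refine continuous_iff_continuousAt.2 fun t => ?_
    rcases eq_or_ne t 0 with rfl | ht
    · exact continuousAt_update_same.2 hlim
    · exact (hupd t ht).continuousAt
  have hleft : IntervalIntegrable f volume (-R) 0 :=
    hf.mono_set (by rw [uIcc_of_le (by linarith), uIcc_of_le (by linarith)]
                    exact Icc_subset_Icc_right hR.le)
  have hright : IntervalIntegrable f volume 0 R :=
    hf.mono_set (by rw [uIcc_of_le (by linarith), uIcc_of_le (by linarith)]
                    exact Icc_subset_Icc_left (by linarith))
  rw [← intervalIntegral.integral_add_adjacent_intervals hleft hright,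
    intervalIntegral.integral_eq_sub_of_hasDerivAt_of_le (by linarith) hcont.continuousOn
      (fun t ht => hupd t ht.2.ne) hleft,
    intervalIntegral.integral_eq_sub_of_hasDerivAt_of_le hR.le hcont.continuousOn
      (fun t ht => hupd t ht.1.ne') hright]
  have h1 : -R ≠ 0 := by linarith
  simp [Function.update_of_ne hR.ne', Function.update_of_ne h1, hneg, hpos]

section divergence

variable {n : ℕ} {a : ℝ}

theorem integral_weighted_last_deriv_eq_zero (ha : -1 < a)
    {g Q : EuclideanSpace ℝ (Fin (n + 1)) → ℝ} (hg : Differentiable ℝ g)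
    (hgsupp : HasCompactSupport g) (hQ : Continuous Q) (hQsupp : HasCompactSupport Q)
    (heq : ∀ X, X (Fin.last n) ≠ 0 →
      Q X = fderiv ℝ g X (EuclideanSpace.single (Fin.last n) 1) + a / X (Fin.last n) * g X)
    (hlim : ∀ X, X (Fin.last n) = 0 → Filter.Tendsto
      (fun t : ℝ => |t| ^ a * g (X + t • EuclideanSpace.single (Fin.last n) (1 : ℝ)))
      (nhdsWithin 0 {t : ℝ | t ≠ 0}) (nhds 0)) :
    ∫ X : EuclideanSpace ℝ (Fin (n + 1)), |X (Fin.last n)| ^ a * Q X = 0 := by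
  refine integral_eq_zero_of_last_line
    ((locallyIntegrable_abs_last_rpow n ha).integrable_smul_right_of_hasCompactSupport hQ hQsupp)
    fun x hx => ?_
  obtain ⟨R₁, hR₁⟩ := hgsupp.isCompact.isBounded.subset_closedBall 0
  obtain ⟨R₂, hR₂⟩ := hQsupp.isCompact.isBounded.subset_closedBall 0
  set γ : ℝ → EuclideanSpace ℝ (Fin (n + 1)) := fun t =>
    x + t • EuclideanSpace.single (Fin.last n) (1 : ℝ) with hγ
  have hγlast : ∀ t, (γ t) (Fin.last n) = t := fun t => by simp [hγ, hx]
  have hγcont : Continuous γ := by fun_prop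
  have hnorm : ∀ t, |t| ≤ ‖γ t‖ := fun t => by
    have := PiLp.norm_apply_le (γ t) (Fin.last n)
    rwa [hγlast] at this
  obtain ⟨R, hR0, hR⟩ : ∃ R, 0 < R ∧ ∀ t, R ≤ |t| → g (γ t) = 0 ∧ Q (γ t) = 0 := by
    refine ⟨max 1 (max R₁ R₂ + 1), by positivity, fun t ht => ⟨?_, ?_⟩⟩
    · refine image_eq_zero_of_notMem_tsupport fun h => ?_
      have h1 : ‖γ t‖ ≤ R₁ := by simpa using hR₁ h
      linarith [hnorm t, le_max_right 1 (max R₁ R₂ + 1), le_max_left R₁ R₂]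
    · refine image_eq_zero_of_notMem_tsupport fun h => ?_
      have h1 : ‖γ t‖ ≤ R₂ := by simpa using hR₂ h
      linarith [hnorm t, le_max_right 1 (max R₁ R₂ + 1), le_max_right R₁ R₂]
  have hsupp : Function.support (fun t => |(γ t) (Fin.last n)| ^ a * Q (γ t)) ⊆ Ioc (-R) R := by
    intro t ht
    by_contra hnot
    refine ht ?_
    have : R ≤ |t| := by
      by_contra hlt
      exact hnot ⟨(abs_lt.1 (not_le.1 hlt)).1, (abs_lt.1 (not_le.1 hlt)).2.le⟩
    simp only [(hR t this).2, mul_zero]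
  change ∫ t, |(γ t) (Fin.last n)| ^ a * Q (γ t) = 0
  rw [← intervalIntegral.integral_eq_integral_of_support_subset hsupp]
  simp only [hγlast]
  refine integral_eq_zero_of_hasDerivAt_of_ne_zero (F := fun t => |t| ^ a * g (γ t)) hR0 ?_ ?_
    (hlim x hx) ?_ ?_
  · rw [intervalIntegrable_iff_integrableOn_Icc_of_le (by linarith)]
    exact (integrableOn_abs_rpow ha R).mul_continuousOn (hQ.comp hγcont).continuousOn isCompact_Icc
  · intro t ht
    have hγder : HasDerivAt γ (EuclideanSpace.single (Fin.last n) (1 : ℝ)) t := by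
      have h := ((hasDerivAt_id t).smul_const
        (EuclideanSpace.single (Fin.last n) (1 : ℝ))).const_add x
      rw [one_smul] at h
      exact h
    have hgder := (hg (γ t)).hasFDerivAt.comp_hasDerivAt t hγder
    refine ((hasDerivAt_abs_rpow_of_ne_zero a ht).mul hgder).congr_deriv ?_
    rw [heq (γ t) (by rwa [hγlast]), hγlast, Function.comp_apply]
    ring
  · simp [(hR (-R) (by rw [abs_neg, abs_of_pos hR0])).1]
  · simp [(hR R (by rw [abs_of_pos hR0])).1]

theorem integral_weighted_tangential_deriv_eq_zero (ha : -1 < a)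
    {g : EuclideanSpace ℝ (Fin (n + 1)) → ℝ} (hg : ContDiff ℝ 1 g)
    (hgsupp : HasCompactSupport g) (i : Fin n) :
    ∫ X : EuclideanSpace ℝ (Fin (n + 1)), |X (Fin.last n)| ^ a *
      fderiv ℝ g X (EuclideanSpace.single i.castSucc 1) = 0 := by
  have hw := locallyIntegrable_abs_last_rpow n ha
  have hder : Continuous fun X => fderiv ℝ g X (EuclideanSpace.single i.castSucc 1) :=
    (hg.continuous_fderiv one_ne_zero).clm_apply continuous_const
  have hdersupp : HasCompactSupport fun X => fderiv ℝ g X (EuclideanSpace.single i.castSucc 1) :=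
    hgsupp.fderiv_apply ℝ _
  have key := integral_bilinear_hasLineDerivAt_right_eq_neg_left_of_integrable
    (μ := (volume : Measure (EuclideanSpace ℝ (Fin (n + 1)))))
    (f := fun X => |X (Fin.last n)| ^ a) (f' := fun _ => 0) (g := g)
    (g' := fun X => fderiv ℝ g X (EuclideanSpace.single i.castSucc 1))
    (v := EuclideanSpace.single i.castSucc 1) (B := ContinuousLinearMap.mul ℝ ℝ)
    (by simp) (hw.integrable_smul_right_of_hasCompactSupport hder hdersupp)
    (hw.integrable_smul_right_of_hasCompactSupport hg.continuous hgsupp)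
    (fun X _ => by
      have : (Fin.last n) ≠ i.castSucc := (Fin.castSucc_lt_last i).ne'
      simpa [HasLineDerivAt, this] using hasDerivAt_const (0 : ℝ) (|X (Fin.last n)| ^ a))
    (fun X _ => (hg.differentiable one_ne_zero X).hasFDerivAt.hasLineDerivAt _)
  simpa using key

theorem integral_weighted_grad_mul_grad_eq_zero (ha : -1 < a) {r : ℝ}
    {w ζ : EuclideanSpace ℝ (Fin (n + 1)) → ℝ} (hw : ContDiff ℝ 2 w) (hζ : ContDiff ℝ 1 ζ)
    (hζr : tsupport ζ ⊆ ball 0 r)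
    (hpde : ∀ X ∈ ball (0 : EuclideanSpace ℝ (Fin (n + 1))) r, X (Fin.last n) ≠ 0 →
      lapl w X + (a / X (Fin.last n)) * lastD w X = 0)
    (hneu : ∀ X ∈ ball (0 : EuclideanSpace ℝ (Fin (n + 1))) r, X (Fin.last n) = 0 →
      Filter.Tendsto
        (fun t : ℝ => |t| ^ a *
          lastD w (X + t • EuclideanSpace.single (Fin.last n) (1 : ℝ)))
        (nhdsWithin 0 {t : ℝ | t ≠ 0}) (nhds 0)) :
    ∫ X : EuclideanSpace ℝ (Fin (n + 1)), |X (Fin.last n)| ^ a *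
      ∑ i, fderiv ℝ w X (EuclideanSpace.single i 1) *
        fderiv ℝ ζ X (EuclideanSpace.single i 1) = 0 := by
  have hζsupp : HasCompactSupport ζ :=
    (isCompact_closedBall 0 r).of_isClosed_subset (isClosed_tsupport ζ)
      (hζr.trans ball_subset_closedBall)
  have hD : ∀ i, ContDiff ℝ 1 fun X => fderiv ℝ w X (EuclideanSpace.single i 1) := fun i =>
    (hw.fderiv_right (m := 1) (by norm_num)).clm_apply contDiff_const
  have hDD : ∀ i, Continuous fun X => fderiv ℝ (fun Y => fderiv ℝ w Y (EuclideanSpace.single i 1)) X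
      (EuclideanSpace.single i 1) := fun i =>
    ((hD i).continuous_fderiv one_ne_zero).clm_apply continuous_const
  have hDζ : ∀ i, Continuous fun X => fderiv ℝ ζ X (EuclideanSpace.single i 1) := fun i =>
    (hζ.continuous_fderiv one_ne_zero).clm_apply continuous_const
  have hDζsupp : ∀ i, HasCompactSupport fun X => fderiv ℝ ζ X (EuclideanSpace.single i 1) :=
    fun i => hζsupp.fderiv_apply ℝ _
  have hprod : ∀ i, ∀ X, fderiv ℝ (fun Y => fderiv ℝ w Y (EuclideanSpace.single i 1) * ζ Y) X
      (EuclideanSpace.single i 1) =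
      fderiv ℝ w X (EuclideanSpace.single i 1) * fderiv ℝ ζ X (EuclideanSpace.single i 1) +
        fderiv ℝ (fun Y => fderiv ℝ w Y (EuclideanSpace.single i 1)) X
          (EuclideanSpace.single i 1) * ζ X := by
    intro i X
    rw [fderiv_fun_mul ((hD i).differentiable one_ne_zero X) (hζ.differentiable one_ne_zero X)]
    simp only [add_apply, smul_apply, smul_eq_mul]
    ring
  have htan : ∀ i : Fin n, _ := fun i => integral_weighted_tangential_deriv_eq_zero ha
    ((hD i.castSucc).mul hζ) hζsupp.mul_left i
  have hlast := integral_weighted_last_deriv_eq_zero ha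
    (g := fun X => fderiv ℝ w X (EuclideanSpace.single (Fin.last n) 1) * ζ X)
    (Q := fun X => fderiv ℝ w X (EuclideanSpace.single (Fin.last n) 1) *
        fderiv ℝ ζ X (EuclideanSpace.single (Fin.last n) 1) -
      (∑ i : Fin n, fderiv ℝ (fun Y => fderiv ℝ w Y (EuclideanSpace.single i.castSucc 1)) X
        (EuclideanSpace.single i.castSucc 1)) * ζ X)
    (((hD _).mul hζ).differentiable one_ne_zero) hζsupp.mul_left
    (((hD _).continuous.mul (hDζ _)).sub
      ((continuous_finsetSum _ fun i _ => hDD _).mul hζ.continuous))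
    ((hDζsupp _).mul_left.sub hζsupp.mul_left) ?_ ?_
  · have hwt := locallyIntegrable_abs_last_rpow n ha
    have hint_tan : ∀ i : Fin n, Integrable fun X : EuclideanSpace ℝ (Fin (n + 1)) =>
        |X (Fin.last n)| ^ a * fderiv ℝ (fun Y => fderiv ℝ w Y
          (EuclideanSpace.single i.castSucc 1) * ζ Y) X (EuclideanSpace.single i.castSucc 1) :=
      fun i => hwt.integrable_smul_right_of_hasCompactSupport
        ((((hD i.castSucc).mul hζ).continuous_fderiv one_ne_zero).clm_apply continuous_const)
        (HasCompactSupport.fderiv_apply ℝ hζsupp.mul_left _)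
    have hint_last : Integrable fun X : EuclideanSpace ℝ (Fin (n + 1)) => |X (Fin.last n)| ^ a *
        (fderiv ℝ w X (EuclideanSpace.single (Fin.last n) 1) *
          fderiv ℝ ζ X (EuclideanSpace.single (Fin.last n) 1) -
        (∑ i : Fin n, fderiv ℝ (fun Y => fderiv ℝ w Y (EuclideanSpace.single i.castSucc 1)) X
          (EuclideanSpace.single i.castSucc 1)) * ζ X) :=
      hwt.integrable_smul_right_of_hasCompactSupport
      (((hD (Fin.last n)).continuous.mul (hDζ (Fin.last n))).sub
        ((continuous_finsetSum Finset.univ fun (i : Fin n) _ => hDD i.castSucc).mul hζ.continuous))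
      ((hDζsupp (Fin.last n)).mul_left.sub hζsupp.mul_left)
    have hsum := integral_add (integrable_finsetSum Finset.univ fun i _ => hint_tan i) hint_last
    rw [integral_finsetSum _ fun i _ => hint_tan i, Finset.sum_eq_zero fun i _ => htan i, hlast,
      zero_add] at hsum
    refine Eq.trans (integral_congr_ae (.of_forall fun X => ?_)) hsum
    simp only [hprod, Fin.sum_univ_castSucc, mul_add, Finset.sum_add_distrib, Finset.mul_sum,
      Finset.sum_mul, mul_sub]
    ring
  · intro X hX
    rw [hprod]
    by_cases hXr : X ∈ ball (0 : EuclideanSpace ℝ (Fin (n + 1))) r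
    · have h := hpde X hXr hX
      rw [lapl, lastD, Fin.sum_univ_castSucc] at h
      linear_combination (-ζ X) * h
    · have h0 : ζ X = 0 := image_eq_zero_of_notMem_tsupport fun h => hXr (hζr h)
      simp [h0]
  · intro X hX
    have hγcont : Continuous fun t : ℝ => X + t • EuclideanSpace.single (Fin.last n) (1 : ℝ) := by
      fun_prop
    by_cases hXr : X ∈ ball (0 : EuclideanSpace ℝ (Fin (n + 1))) r
    · have h1 := (hneu X hXr hX).mul
        (((hζ.continuous.comp hγcont).continuousAt (x := 0)).tendsto.mono_left
          (nhdsWithin_le_nhds (s := {t : ℝ | t ≠ 0})))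
      rw [zero_mul] at h1
      refine h1.congr fun t => ?_
      simp only [lastD, Function.comp_apply]
      ring
    · refine tendsto_const_nhds.congr' (Filter.EventuallyEq.filter_mono ?_ nhdsWithin_le_nhds)
      have hX0 : X + (0 : ℝ) • EuclideanSpace.single (Fin.last n) (1 : ℝ) ∈ (tsupport ζ)ᶜ := by
        simpa using fun h => hXr (hζr h)
      filter_upwards [hγcont.continuousAt.preimage_mem_nhds
        ((isClosed_tsupport ζ).isOpen_compl.mem_nhds hX0)] with t ht
      have h0 := image_eq_zero_of_notMem_tsupport ht
      simp [h0]

theorem integral_weighted_cutoff_radial_deriv_eq_zero (ha : -1 < a) {r : ℝ}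
    {w : EuclideanSpace ℝ (Fin (n + 1)) → ℝ} (hw : ContDiff ℝ 2 w)
    (hpde : ∀ X ∈ ball (0 : EuclideanSpace ℝ (Fin (n + 1))) r, X (Fin.last n) ≠ 0 →
      lapl w X + (a / X (Fin.last n)) * lastD w X = 0)
    (hneu : ∀ X ∈ ball (0 : EuclideanSpace ℝ (Fin (n + 1))) r, X (Fin.last n) = 0 →
      Filter.Tendsto
        (fun t : ℝ => |t| ^ a *
          lastD w (X + t • EuclideanSpace.single (Fin.last n) (1 : ℝ)))
        (nhdsWithin 0 {t : ℝ | t ≠ 0}) (nhds 0)) {ρ : ℝ} (hρ : ρ ∈ Ioo 0 r) :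
    ∫ X : EuclideanSpace ℝ (Fin (n + 1)),
      |X (Fin.last n)| ^ a * (max (ρ ^ 2 - ‖X‖ ^ 2) 0 * fderiv ℝ w X X) = 0 := by
  have hsq : ∀ t : ℝ, HasDerivAt (fun t : ℝ => max t 0 ^ 2) (2 * max t 0) t := by
    intro t
    rcases lt_trichotomy t 0 with ht | rfl | ht
    · rw [max_eq_right ht.le, mul_zero]
      refine (hasDerivAt_const t (0 : ℝ)).congr_of_eventuallyEq ?_
      filter_upwards [isOpen_Iio.mem_nhds ht] with s hs
      simp [max_eq_right (le_of_lt (mem_Iio.1 hs))]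
    · rw [max_self, mul_zero, hasDerivAt_iff_isLittleO_nhds_zero]
      have hO : (fun h : ℝ => max h 0 ^ 2) =O[nhds 0] fun h => h ^ 2 :=
        Asymptotics.IsBigO.of_bound 1 (.of_forall fun h => by
          rw [one_mul, Real.norm_of_nonneg (by positivity), Real.norm_of_nonneg (by positivity)]
          rcases le_total h 0 with hh | hh
          · rw [max_eq_right hh, zero_pow two_ne_zero]
            positivity
          · rw [max_eq_left hh])
      have ho : (fun h : ℝ => h ^ 2) =o[nhds 0] fun h => h := by
        simpa using Asymptotics.isLittleO_pow_id (𝕜 := ℝ) one_lt_two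
      simpa using hO.trans_isLittleO ho
    · rw [max_eq_left ht.le]
      have h := hasDerivAt_pow 2 t
      norm_num at h
      refine h.congr_of_eventuallyEq ?_
      filter_upwards [isOpen_Ioi.mem_nhds ht] with s hs
      rw [max_eq_left (le_of_lt (mem_Ioi.1 hs))]
  have hsqC : ContDiff ℝ 1 fun t : ℝ => max t 0 ^ 2 := by
    refine contDiff_one_iff_deriv.2 ⟨fun t => (hsq t).differentiableAt, ?_⟩
    rw [show deriv (fun t : ℝ => max t 0 ^ 2) = fun t => 2 * max t 0 from
      funext fun t => (hsq t).deriv]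
    fun_prop
  have hζ : ContDiff ℝ 1 fun X : EuclideanSpace ℝ (Fin (n + 1)) =>
      max (ρ ^ 2 - ‖X‖ ^ 2) 0 ^ 2 :=
    hsqC.comp (contDiff_const.sub (contDiff_norm_sq ℝ))
  have hζr : tsupport (fun X : EuclideanSpace ℝ (Fin (n + 1)) =>
      max (ρ ^ 2 - ‖X‖ ^ 2) 0 ^ 2) ⊆ ball 0 r := by
    refine (closure_minimal (fun X hX => ?_) isClosed_closedBall).trans
      (closedBall_subset_ball hρ.2)
    rw [mem_closedBall_zero_iff]
    by_contra! hlt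
    refine hX ?_
    have : ρ ^ 2 - ‖X‖ ^ 2 ≤ 0 := by nlinarith [hρ.1]
    simp [max_eq_right this]
  have hgrad := integral_weighted_grad_mul_grad_eq_zero ha hw hζ hζr hpde hneu
  have hfd : ∀ X v : EuclideanSpace ℝ (Fin (n + 1)),
      fderiv ℝ (fun X : EuclideanSpace ℝ (Fin (n + 1)) => max (ρ ^ 2 - ‖X‖ ^ 2) 0 ^ 2) X v =
        -4 * max (ρ ^ 2 - ‖X‖ ^ 2) 0 * inner ℝ X v := by
    intro X v
    have h1 : HasFDerivAt (fun X : EuclideanSpace ℝ (Fin (n + 1)) => ρ ^ 2 - ‖X‖ ^ 2)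
        (-(2 • innerSL ℝ X)) X := (hasStrictFDerivAt_norm_sq X).hasFDerivAt.const_sub (ρ ^ 2)
    have h2 := (hsq (ρ ^ 2 - ‖X‖ ^ 2)).comp_hasFDerivAt X h1
    have h3 := h2.fderiv
    simp only [Function.comp_def] at h3
    rw [h3]
    simp
    ring
  have hsum : ∀ X : EuclideanSpace ℝ (Fin (n + 1)),
      ∑ i, fderiv ℝ w X (EuclideanSpace.single i 1) * fderiv ℝ
        (fun X : EuclideanSpace ℝ (Fin (n + 1)) => max (ρ ^ 2 - ‖X‖ ^ 2) 0 ^ 2) X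
          (EuclideanSpace.single i 1) =
      -4 * (max (ρ ^ 2 - ‖X‖ ^ 2) 0 * fderiv ℝ w X X) := by
    intro X
    have hX : fderiv ℝ w X X = ∑ i, X i * fderiv ℝ w X (EuclideanSpace.single i 1) := by
      have h := congrArg (fderiv ℝ w X) ((EuclideanSpace.basisFun (Fin (n + 1)) ℝ).sum_repr X)
      rw [map_sum] at h
      simpa using h.symm
    rw [hX, Finset.mul_sum, Finset.mul_sum]
    refine Finset.sum_congr rfl fun i _ => ?_
    rw [hfd, EuclideanSpace.inner_single_right]
    simp
    ring
  simp only [hsum, mul_left_comm _ (-4 : ℝ), integral_const_mul] at hgrad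
  simpa using hgrad

end divergence

theorem lastD_comp_add_left {n : ℕ} (v : EuclideanSpace ℝ (Fin (n + 1)) → ℝ)
    (X₀ X : EuclideanSpace ℝ (Fin (n + 1))) :
    lastD (fun Y => v (X₀ + Y)) X = lastD v (X₀ + X) := by
  simp only [lastD, fderiv_comp_add_left]

theorem lapl_comp_add_left {n : ℕ} (v : EuclideanSpace ℝ (Fin (n + 1)) → ℝ)
    (X₀ X : EuclideanSpace ℝ (Fin (n + 1))) :
    lapl (fun Y => v (X₀ + Y)) X = lapl v (X₀ + X) := by
  simp only [lapl, fderiv_comp_add_left]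
  exact Finset.sum_congr rfl fun i _ => by
    rw [fderiv_comp_add_left (f := fun Y => fderiv ℝ v Y (EuclideanSpace.single i 1)) X₀]

theorem Filter.EventuallyEq.lastD_eq {n : ℕ} {u v : EuclideanSpace ℝ (Fin (n + 1)) → ℝ}
    {X : EuclideanSpace ℝ (Fin (n + 1))} (h : v =ᶠ[nhds X] u) : lastD v X = lastD u X := by
  rw [lastD, lastD, h.fderiv_eq]

theorem Filter.EventuallyEq.lapl_eq {n : ℕ} {u v : EuclideanSpace ℝ (Fin (n + 1)) → ℝ}
    {X : EuclideanSpace ℝ (Fin (n + 1))} (h : v =ᶠ[nhds X] u) : lapl v X = lapl u X := by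
  refine Finset.sum_congr rfl fun i _ => ?_
  have hi : (fun Y => fderiv ℝ v Y (EuclideanSpace.single i 1)) =ᶠ[nhds X]
      fun Y => fderiv ℝ u Y (EuclideanSpace.single i 1) := by
    filter_upwards [h.fderiv (𝕜 := ℝ)] with Y hY
    rw [hY]
  rw [hi.fderiv_eq]

theorem exists_contDiff_hasCompactSupport_eqOn_closedBall {E : Type*} [NormedAddCommGroup E]
    [InnerProductSpace ℝ E] [FiniteDimensional ℝ E] {k : ℕ∞} {Ω : Set E} (hΩ : IsOpen Ω) {u : E → ℝ}
    (hu : ContDiffOn ℝ k u Ω) {x : E} {r : ℝ} (hr : 0 < r) (hball : closedBall x r ⊆ Ω) :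
    ∃ v : E → ℝ, ContDiff ℝ k v ∧ HasCompactSupport v ∧ EqOn v u (closedBall x r) := by
  obtain ⟨δ, hδ, hδΩ⟩ := (isCompact_closedBall x r).exists_cthickening_subset_open hΩ hball
  rw [cthickening_closedBall hδ.le hr.le] at hδΩ
  let χ : ContDiffBump x := ⟨r, δ + r, hr, by linarith⟩
  have hχ : tsupport χ ⊆ Ω := by
    rw [χ.tsupport_eq]
    exact hδΩ
  refine ⟨fun y => χ y * u y, contDiff_iff_contDiffAt.2 fun y => ?_,
    χ.hasCompactSupport.mul_right, fun y hy => ?_⟩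
  · by_cases hy : y ∈ tsupport χ
    · exact χ.contDiff.contDiffAt.mul (hu.contDiffAt (hΩ.mem_nhds (hχ hy)))
    · refine contDiffAt_const (c := (0 : ℝ)) |>.congr_of_eventuallyEq ?_
      filter_upwards [(isClosed_tsupport χ).isOpen_compl.mem_nhds hy] with z hz
      rw [image_eq_zero_of_notMem_tsupport hz, zero_mul]
  · simp only [χ.one_of_mem_closedBall hy, one_mul]

/-- Weighted mean value property: if `a > -1` and `u` is `C²` on an open set
containing the closed ball `B̄_r(X₀)` with `X₀` on `{y = 0}`, satisfies
`Δu + (a/y)∂_y u = 0` on `{y ≠ 0}` and `|y|^a ∂_y u → 0` as `y → 0`, then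
`u(X₀) = (1/(|Sⁿ|_a r^{n+a})) ∫_{∂B_r(X₀)} |y|^a u dσ`. -/
theorem weighted_mean_value_property (n : ℕ) (a : ℝ) (ha : -1 < a)
    (Ω : Set (EuclideanSpace ℝ (Fin (n + 1)))) (hΩ : IsOpen Ω)
    (u : EuclideanSpace ℝ (Fin (n + 1)) → ℝ) (hu : ContDiffOn ℝ 2 u Ω)
    (hpde : ∀ X ∈ Ω, X (Fin.last n) ≠ 0 →
      lapl u X + (a / X (Fin.last n)) * lastD u X = 0)
    (hneu : ∀ X ∈ Ω, X (Fin.last n) = 0 →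
      Filter.Tendsto
        (fun t : ℝ => |t| ^ a *
          lastD u (X + t • EuclideanSpace.single (Fin.last n) (1 : ℝ)))
        (nhdsWithin 0 {t : ℝ | t ≠ 0}) (nhds 0))
    (X₀ : EuclideanSpace ℝ (Fin (n + 1))) (hX₀ : X₀ (Fin.last n) = 0)
    (r : ℝ) (hr : 0 < r) (hball : Metric.closedBall X₀ r ⊆ Ω) :
    u X₀ = (1 / (sphInt n (fun X => |X (Fin.last n)| ^ a) 0 1 * r ^ ((n : ℝ) + a))) *
      sphInt n (fun X => |X (Fin.last n)| ^ a * u X) X₀ r := by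
  obtain ⟨v, hv, hvsupp, hvu⟩ :=
    exists_contDiff_hasCompactSupport_eqOn_closedBall (k := 2) hΩ hu hr hball
  have hvu_nhds : ∀ X ∈ ball X₀ r, v =ᶠ[nhds X] u := fun X hX => by
    filter_upwards [isOpen_ball.mem_nhds hX] with Y hY using hvu (ball_subset_closedBall hY)
  have hmem : ∀ {X : EuclideanSpace ℝ (Fin (n + 1))}, X ∈ ball 0 r → X₀ + X ∈ ball X₀ r := by
    simp
  have hlast : ∀ X : EuclideanSpace ℝ (Fin (n + 1)), (X₀ + X) (Fin.last n) = X (Fin.last n) := by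
    simp [hX₀]
  have hw : ContDiff ℝ 2 fun X => v (X₀ + X) := hv.comp (contDiff_const.add contDiff_id)
  have hwsupp : HasCompactSupport fun X => v (X₀ + X) :=
    hvsupp.comp_homeomorph (Homeomorph.addLeft X₀)
  have hwpde : ∀ X ∈ ball (0 : EuclideanSpace ℝ (Fin (n + 1))) r, X (Fin.last n) ≠ 0 →
      lapl (fun Y => v (X₀ + Y)) X + (a / X (Fin.last n)) * lastD (fun Y => v (X₀ + Y)) X = 0 := by
    intro X hX hX0
    have h := hpde (X₀ + X) (hball (ball_subset_closedBall (hmem hX))) (by rwa [hlast])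
    rwa [hlast, ← (hvu_nhds _ (hmem hX)).lapl_eq, ← (hvu_nhds _ (hmem hX)).lastD_eq,
      ← lapl_comp_add_left, ← lastD_comp_add_left] at h
  have hwneu : ∀ X ∈ ball (0 : EuclideanSpace ℝ (Fin (n + 1))) r, X (Fin.last n) = 0 →
      Filter.Tendsto
        (fun t : ℝ => |t| ^ a * lastD (fun Y => v (X₀ + Y))
          (X + t • EuclideanSpace.single (Fin.last n) (1 : ℝ)))
        (nhdsWithin 0 {t : ℝ | t ≠ 0}) (nhds 0) := by
    intro X hX hX0
    refine (hneu (X₀ + X) (hball (ball_subset_closedBall (hmem hX))) (by rwa [hlast])).congr'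
      (Filter.EventuallyEq.filter_mono ?_ nhdsWithin_le_nhds)
    have hline : Continuous fun t : ℝ => X + t • EuclideanSpace.single (Fin.last n) (1 : ℝ) := by
      fun_prop
    have h0 : X + (0 : ℝ) • EuclideanSpace.single (Fin.last n) (1 : ℝ) ∈ ball 0 r := by
      rwa [zero_smul, add_zero]
    filter_upwards [(isOpen_ball.preimage hline).mem_nhds h0] with t ht
    rw [lastD_comp_add_left, (hvu_nhds _ (hmem ht)).lastD_eq, add_assoc]
  have key := weighted_sphere_integral_eq_of_integral_cutoff_eq_zero ha (hw.of_le one_le_two) hwsupp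
    hr fun ρ hρ => integral_weighted_cutoff_radial_deriv_eq_zero ha hw hwpde hwneu hρ
  have hunit : sphInt n (fun X => |X (Fin.last n)| ^ a) 0 1 =
      ∫ ω, |(ω : EuclideanSpace ℝ (Fin (n + 1))) (Fin.last n)| ^ a ∂(sphereMeasure n) := by
    simp [sphInt]
  have hsphere : sphInt n (fun X => |X (Fin.last n)| ^ a * u X) X₀ r =
      r ^ ((n : ℝ) + a) * ∫ ω, |(ω : EuclideanSpace ℝ (Fin (n + 1))) (Fin.last n)| ^ a *
        v (X₀ + r • (ω : EuclideanSpace ℝ (Fin (n + 1)))) ∂(sphereMeasure n) := by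
    rw [sphInt, Real.rpow_add hr, Real.rpow_natCast, mul_assoc, ← integral_const_mul (r ^ a)]
    refine congrArg (r ^ n * ·) (integral_congr_ae (.of_forall fun ω => ?_))
    dsimp only
    have hω : X₀ + r • (ω : EuclideanSpace ℝ (Fin (n + 1))) ∈ closedBall X₀ r := by
      simp [norm_smul, abs_of_pos hr]
    rw [hlast, hvu hω, PiLp.smul_apply, smul_eq_mul, abs_mul, abs_of_pos hr,
      Real.mul_rpow hr.le (abs_nonneg _)]
    ring
  have hpos := integral_abs_last_rpow_sphereMeasure_pos n ha
  rw [hsphere, hunit, key, add_zero, hvu (mem_closedBall_self hr.le)]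
  field_simp
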